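/- Let ψ : ℂ[T₁,T₂,T₃,T₄,T₅] → ℂ[z₁,z₂,z₃,z₄,z₅,z₆] be the ℂ-algebra homomorphism with ψ(T₁) = z₁z₃, ψ(T₂) = z₂z₅, ψ(T₃) = z₄z₆, ψ(T₄) = z₁z₄z₅, ψ(T₅) = z₂z₃z₆. Then the kernel of ψ is the principal ideal generated by T₁T₂T₃ − T₄T₅. -/

import Mathlib

open MvPolynomial

/-- `ψ(T₁)=z₁z₃, ψ(T₂)=z₂z₅, ψ(T₃)=z₄z₆, ψ(T₄)=z₁z₄z₅, ψ(T₅)=z₂z₃z₆`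
(variables indexed by `Fin 5` and `Fin 6`, zero-based). -/
noncomputable def psiC : MvPolynomial (Fin 5) ℂ →ₐ[ℂ] MvPolynomial (Fin 6) ℂ :=
  aeval ![X 0 * X 2, X 1 * X 4, X 3 * X 5, X 0 * X 3 * X 4, X 1 * X 2 * X 5]

/-- The linear map sending a monomial in the image of `psiC` to its unique monomial preimage
that is not divisible by `T₄T₅`. -/
noncomputable def normalFormPreimage :
    MvPolynomial (Fin 6) ℂ →ₗ[ℂ] MvPolynomial (Fin 5) ℂ :=
  (basisMonomials (Fin 6) ℂ).constr ℂ fun e =>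
    X 0 ^ min (e 0) (e 2) * X 1 ^ min (e 1) (e 4) * X 2 ^ min (e 3) (e 5) *
      X 3 ^ (e 0 - e 2) * X 4 ^ (e 2 - e 0)

theorem normalFormPreimage_prod_X_pow (a b c d e f : ℕ) :
    normalFormPreimage (X 0 ^ a * X 1 ^ b * X 2 ^ c * X 3 ^ d * X 4 ^ e * X 5 ^ f) =
      X 0 ^ min a c * X 1 ^ min b e * X 2 ^ min d f * X 3 ^ (a - c) * X 4 ^ (c - a) := by
  have h : (X 0 ^ a * X 1 ^ b * X 2 ^ c * X 3 ^ d * X 4 ^ e * X 5 ^ f :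
      MvPolynomial (Fin 6) ℂ) =
      basisMonomials (Fin 6) ℂ (Finsupp.equivFunOnFinite.symm ![a, b, c, d, e, f]) := by
    simp [monomial_eq, Finsupp.prod_fintype, Fin.prod_univ_six]
  rw [h, normalFormPreimage, Module.Basis.constr_basis]
  simp

theorem monomial_one_eq_prod_X_pow (a : Fin 5 →₀ ℕ) :
    (monomial a 1 : MvPolynomial (Fin 5) ℂ) =
      X 0 ^ a 0 * X 1 ^ a 1 * X 2 ^ a 2 * X 3 ^ a 3 * X 4 ^ a 4 := by
  simp [monomial_eq, Finsupp.prod_fintype, Fin.prod_univ_five]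

theorem psiC_monomial_one (a : Fin 5 →₀ ℕ) :
    psiC (monomial a 1) =
      X 0 ^ (a 0 + a 3) * X 1 ^ (a 1 + a 4) * X 2 ^ (a 0 + a 4) * X 3 ^ (a 2 + a 3) *
        X 4 ^ (a 1 + a 3) * X 5 ^ (a 2 + a 4) := by
  rw [monomial_one_eq_prod_X_pow]
  simp [psiC]
  ring

theorem prod_pow_eq_of_mul_eq {R : Type*} [CommRing R] {x y z u v : R}
    (h : x * y * z = u * v) (a b c d e : ℕ) :
    x ^ min (a + d) (a + e) * y ^ min (b + e) (b + d) * z ^ min (c + d) (c + e) *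
      u ^ (a + d - (a + e)) * v ^ (a + e - (a + d)) =
      x ^ a * y ^ b * z ^ c * u ^ d * v ^ e := by
  have hpow (n : ℕ) : x ^ n * y ^ n * z ^ n = u ^ n * v ^ n := by
    rw [← mul_pow, ← mul_pow, h, mul_pow]
  rw [min_comm (b + e), Nat.add_sub_add_left, Nat.add_sub_add_left]
  simp only [Nat.add_min_add_left]
  rcases Nat.le_total d e with hde | hde <;> obtain ⟨k, rfl⟩ := Nat.exists_eq_add_of_le hde
  · simp only [le_add_iff_nonneg_right, zero_le, inf_of_le_left, Nat.sub_add_eq, Nat.sub_self,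
      Nat.zero_sub, Nat.add_sub_cancel_left, pow_add]
    linear_combination x ^ a * y ^ b * z ^ c * v ^ k * hpow d
  · simp only [le_add_iff_nonneg_right, zero_le, inf_of_le_right, Nat.sub_add_eq, Nat.sub_self,
      Nat.zero_sub, Nat.add_sub_cancel_left, pow_add]
    linear_combination x ^ a * y ^ b * z ^ c * u ^ k * hpow e

theorem mk_normalFormPreimage_psiC (p : MvPolynomial (Fin 5) ℂ) :
    Ideal.Quotient.mk (Ideal.span {(X 0 * X 1 * X 2 - X 3 * X 4 : MvPolynomial (Fin 5) ℂ)})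
      (normalFormPreimage (psiC p)) = Ideal.Quotient.mk _ p := by
  set I := Ideal.span {(X 0 * X 1 * X 2 - X 3 * X 4 : MvPolynomial (Fin 5) ℂ)}
  have hrel : Ideal.Quotient.mk I (X 0) * Ideal.Quotient.mk I (X 1) * Ideal.Quotient.mk I (X 2) =
      Ideal.Quotient.mk I (X 3) * Ideal.Quotient.mk I (X 4) := by
    simp only [← map_mul]
    exact Ideal.Quotient.eq.2 (Ideal.mem_span_singleton_self _)
  have hlin : (Ideal.Quotient.mkₐ ℂ I).toLinearMap ∘ₗ normalFormPreimage ∘ₗ psiC.toLinearMap =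
      (Ideal.Quotient.mkₐ ℂ I).toLinearMap := by
    refine (basisMonomials (Fin 5) ℂ).ext fun a => ?_
    simp only [coe_basisMonomials, LinearMap.comp_apply, AlgHom.toLinearMap_apply,
      psiC_monomial_one, normalFormPreimage_prod_X_pow, Ideal.Quotient.mkₐ_eq_mk]
    rw [monomial_one_eq_prod_X_pow]
    simp only [map_mul, map_pow]
    exact prod_pow_eq_of_mul_eq hrel _ _ _ _ _
  exact LinearMap.congr_fun hlin p

theorem stmt_8 :
    RingHom.ker psiC.toRingHom =
      Ideal.span {(X 0 * X 1 * X 2 - X 3 * X 4 : MvPolynomial (Fin 5) ℂ)} := by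
  apply le_antisymm
  · intro p hp
    have hp' : psiC p = 0 := hp
    rw [← Ideal.Quotient.eq_zero_iff_mem, ← mk_normalFormPreimage_psiC, hp', map_zero, map_zero]
  · rw [Ideal.span_singleton_le_iff_mem]
    change psiC _ = 0
    simp [psiC]
    ring
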